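/- arXiv:1410.0879 — 9 statements merged into one kernel-verified Lean document; each statement's English description precedes it below -/
import Mathlib

section
/- For all distinct robots i, j ∈ R and all x, y ∈ χ^free_{i≻j}, both the componentwise maximum max{x, y} and the componentwise minimum min{x, y} belong to χ^free_{i≻j}. -/
open Set

noncomputable section

/-- Canonical basis vector `e i` of the coordination space `ℝ^n`. -/
def basisVec (n : ℕ) (i : Fin n) : Fin n → ℝ := Pi.single i 1

/-- Collision cylinder `χ^obs_{ij} = {x : (x i, x j) ∈ κ i j}`. -/
def cyl (n : ℕ) (κ : Fin n → Fin n → Set (ℝ × ℝ)) (i j : Fin n) : Set (Fin n → ℝ) :=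
  {x | (x i, x j) ∈ κ i j}

/-- Completed cylinder `χ^obs_{i≻j} = χ^obs_{ij} − ℝ₊ e_i + ℝ₊ e_j` (Minkowski sums). -/
def cylPr (n : ℕ) (κ : Fin n → Fin n → Set (ℝ × ℝ)) (i j : Fin n) : Set (Fin n → ℝ) :=
  {z | ∃ y ∈ cyl n κ i j, ∃ a b : ℝ, 0 ≤ a ∧ 0 ≤ b ∧
    z = y - a • basisVec n i + b • basisVec n j}

/-- Obstacle region `χ^obs = ⋃_{i,j} χ^obs_{ij}`. -/
def obsRegion (n : ℕ) (κ : Fin n → Fin n → Set (ℝ × ℝ)) : Set (Fin n → ℝ) :=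
  ⋃ i, ⋃ j, cyl n κ i j

/-- Obstacle-free region `χ^free = χ \ χ^obs`. -/
def freeRegion (n : ℕ) (κ : Fin n → Fin n → Set (ℝ × ℝ)) : Set (Fin n → ℝ) :=
  (obsRegion n κ)ᶜ

/-- Standing hypotheses on the collision data `κ`: each `κ i j` is open, bounded and
convex, `κ i i = ∅`, and `(a,b) ∈ κ i j ↔ (b,a) ∈ κ j i`. -/
def KappaHyp (n : ℕ) (κ : Fin n → Fin n → Set (ℝ × ℝ)) : Prop :=
  (∀ i j, IsOpen (κ i j)) ∧ (∀ i j, Bornology.IsBounded (κ i j)) ∧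
  (∀ i j, Convex ℝ (κ i j)) ∧ (∀ i, κ i i = ∅) ∧
  (∀ (i j : Fin n) (a b : ℝ), (a, b) ∈ κ i j ↔ (b, a) ∈ κ j i)

/-- `PhiMem n C φ` : `φ` restricted to `[0,1]` is a continuous nondecreasing path whose
image lies in `C`, with `φ 0 − ℝ₊^n ⊆ C` and `φ 1 + ℝ₊^n ⊆ C` (the set `Φ(C)`). -/
def PhiMem (n : ℕ) (C : Set (Fin n → ℝ)) (φ : ℝ → Fin n → ℝ) : Prop :=
  ContinuousOn φ (Icc 0 1) ∧
  (∀ t1 ∈ Icc (0:ℝ) 1, ∀ t2 ∈ Icc (0:ℝ) 1, t1 ≤ t2 → φ t1 ≤ φ t2) ∧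
  (∀ t ∈ Icc (0:ℝ) 1, φ t ∈ C) ∧
  (∀ d : Fin n → ℝ, 0 ≤ d → φ 0 - d ∈ C) ∧
  (∀ d : Fin n → ℝ, 0 ≤ d → φ 1 + d ∈ C)

/-- Membership in a completed cylinder only involves the coordinates `i` and `j`, and is
monotone: it says that `(z i, z j)` lies weakly left of and above a point of `κ i j`. -/
theorem mem_cylPr_iff {n : ℕ} {κ : Fin n → Fin n → Set (ℝ × ℝ)} {i j : Fin n} (hij : i ≠ j)
    {z : Fin n → ℝ} :
    z ∈ cylPr n κ i j ↔ ∃ p q : ℝ, (p, q) ∈ κ i j ∧ z i ≤ p ∧ q ≤ z j := by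
  constructor
  · rintro ⟨y, hy, a, b, ha, hb, rfl⟩
    refine ⟨y i, y j, hy, ?_, ?_⟩
    · simp [basisVec, hij, ha]
    · simp [basisVec, hij.symm, hb]
  · rintro ⟨p, q, hpq, hp, hq⟩
    refine ⟨z + (p - z i) • basisVec n i - (z j - q) • basisVec n j, ?_,
      p - z i, z j - q, sub_nonneg.2 hp, sub_nonneg.2 hq, by abel⟩
    simpa [cyl, basisVec, hij, hij.symm] using hpq

/-- `χ^free_{i≻j}` is stable under componentwise `max` and `min`. -/
theorem stmt1 (n : ℕ) (hn : 1 ≤ n) (κ : Fin n → Fin n → Set (ℝ × ℝ))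
    (hκ : KappaHyp n κ) (i j : Fin n) (hij : i ≠ j) (x y : Fin n → ℝ)
    (hx : x ∉ cylPr n κ i j) (hy : y ∉ cylPr n κ i j) :
    x ⊔ y ∉ cylPr n κ i j ∧ x ⊓ y ∉ cylPr n κ i j := by
  rw [mem_cylPr_iff hij] at hx hy
  simp only [mem_cylPr_iff hij, Pi.sup_apply, Pi.inf_apply]
  constructor
  · rintro ⟨p, q, hpq, hp, hq⟩
    obtain ⟨hxp, hyp⟩ := sup_le_iff.1 hp
    rcases le_sup_iff.1 hq with hq | hq
    · exact hx ⟨p, q, hpq, hxp, hq⟩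
    · exact hy ⟨p, q, hpq, hyp, hq⟩
  · rintro ⟨p, q, hpq, hp, hq⟩
    obtain ⟨hqx, hqy⟩ := le_inf_iff.1 hq
    rcases inf_le_iff.1 hp with hp | hp
    · exact hx ⟨p, q, hpq, hp, hqx⟩
    · exact hy ⟨p, q, hpq, hp, hqy⟩
end
end

section
/- For all distinct robots i, j ∈ R and every y ∈ χ^obs_{ij}, the hyperplane {x ∈ χ : x_i = y_i} is contained in χ^obs_{i≻j} ∪ χ^obs_{j≻i}. -/
open Set

noncomputable section

/-- for `y ∈ χ^obs_{ij}`, the hyperplane `{x : x i = y i}` is contained in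
`χ^obs_{i≻j} ∪ χ^obs_{j≻i}`. -/
theorem stmt2 (n : ℕ) (hn : 1 ≤ n) (κ : Fin n → Fin n → Set (ℝ × ℝ))
    (hκ : KappaHyp n κ) (i j : Fin n) (hij : i ≠ j) (y : Fin n → ℝ)
    (hy : y ∈ cyl n κ i j) :
    {x : Fin n → ℝ | x i = y i} ⊆ cylPr n κ i j ∪ cylPr n κ j i := by
  intro x (hx : x i = y i)
  have hz : Function.update x j (y j) ∈ cyl n κ i j := by
    simpa [cyl, Function.update_of_ne hij, hx] using hy
  rcases le_total (y j) (x j) with h | h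
  · refine Or.inl ⟨Function.update x j (y j), hz, 0, x j - y j, le_rfl, sub_nonneg.2 h, ?_⟩
    ext k
    rcases eq_or_ne k j with rfl | hk
    · simp [basisVec]
    · simp [basisVec, hk]
  · refine Or.inr ⟨Function.update x j (y j), (hκ.2.2.2.2 i j _ _).1 hz, y j - x j, 0,
      sub_nonneg.2 h, le_rfl, ?_⟩
    ext k
    rcases eq_or_ne k j with rfl | hk
    · simp [basisVec]
    · simp [basisVec, hk]
end
end

section
/- (South-West/North-East completion.) For every feasible path φ and all distinct robots i, j ∈ R, the image of φ is disjoint from χ^obs_{i≻j} ∩ χ^obs_{j≻i}. -/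
open Set

noncomputable section

/-- A point of the bounding box of a non-increasing segment that lies on the line spanned by
the segment lies in every convex set containing both ends. -/
theorem Convex.mem_of_mem_box_of_mem_line {K : Set (ℝ × ℝ)} (hK : Convex ℝ K)
    {w₁ w₂ u₁ u₂ r₁ r₂ : ℝ} (hw : (w₁, w₂) ∈ K) (hu : (u₁, u₂) ∈ K)
    (h₁ : r₁ ∈ Icc w₁ u₁) (h₂ : r₂ ∈ Icc u₂ w₂)
    (hl : (w₂ - u₂) * r₁ + (u₁ - w₁) * r₂ = (w₂ - u₂) * w₁ + (u₁ - w₁) * w₂) :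
    (r₁, r₂) ∈ K := by
  obtain ⟨h₁l, h₁u⟩ := h₁
  obtain ⟨h₂l, h₂u⟩ := h₂
  have key : ∀ s : ℝ, 0 ≤ s → s ≤ 1 → r₁ = w₁ + s * (u₁ - w₁) → r₂ = w₂ + s * (u₂ - w₂) →
      (r₁, r₂) ∈ K := by
    intro s hs₀ hs₁ e₁ e₂
    have h := hK hw hu (sub_nonneg.2 hs₁) hs₀ (by ring)
    convert h using 1
    ext <;> simp [e₁, e₂] <;> ring
  rcases (h₁l.trans h₁u).eq_or_lt with hβ | hβ
  · rcases (h₂l.trans h₂u).eq_or_lt with hα | hα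
    · exact key 0 le_rfl zero_le_one (by linarith) (by linarith)
    · have hα' : 0 < w₂ - u₂ := sub_pos.2 hα
      refine key ((w₂ - r₂) / (w₂ - u₂)) (div_nonneg (by linarith) hα'.le)
        ((div_le_one hα').2 (by linarith)) ?_ ?_
      · rw [← hβ]; linarith
      · field_simp; ring
  · have hβ' : 0 < u₁ - w₁ := sub_pos.2 hβ
    refine key ((r₁ - w₁) / (u₁ - w₁)) (div_nonneg (by linarith) hβ'.le)
      ((div_le_one hβ').2 (by linarith)) ?_ ?_
    · field_simp; ring
    · field_simp; linarith

/-- If `p` lies in the bounding box of a strictly decreasing segment, then every point of the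
line spanned by the segment that dominates `p` lies in the box. -/
theorem mem_box_of_le_of_mem_line {w₁ w₂ u₁ u₂ p₁ p₂ r₁ r₂ : ℝ}
    (hβ : w₁ < u₁) (hα : u₂ < w₂) (hp₁ : w₁ ≤ p₁) (hp₂ : u₂ ≤ p₂)
    (h₁ : p₁ ≤ r₁) (h₂ : p₂ ≤ r₂)
    (hl : (w₂ - u₂) * r₁ + (u₁ - w₁) * r₂ = (w₂ - u₂) * w₁ + (u₁ - w₁) * w₂) :
    r₁ ∈ Icc w₁ u₁ ∧ r₂ ∈ Icc u₂ w₂ := by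
  refine ⟨⟨hp₁.trans h₁, ?_⟩, hp₂.trans h₂, ?_⟩ <;> by_contra! h
  · nlinarith [mul_pos (sub_pos.2 hα) (sub_pos.2 h),
      mul_nonneg (sub_pos.2 hβ).le (sub_nonneg.2 (hp₂.trans h₂))]
  · nlinarith [mul_pos (sub_pos.2 hβ) (sub_pos.2 h),
      mul_nonneg (sub_pos.2 hα).le (sub_nonneg.2 (hp₁.trans h₁))]

/-- If `p` lies in the bounding box of a strictly decreasing segment, then every point of the
line spanned by the segment that is dominated by `p` lies in the box. -/
theorem mem_box_of_ge_of_mem_line {w₁ w₂ u₁ u₂ p₁ p₂ r₁ r₂ : ℝ}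
    (hβ : w₁ < u₁) (hα : u₂ < w₂) (hp₁ : p₁ ≤ u₁) (hp₂ : p₂ ≤ w₂)
    (h₁ : r₁ ≤ p₁) (h₂ : r₂ ≤ p₂)
    (hl : (w₂ - u₂) * r₁ + (u₁ - w₁) * r₂ = (w₂ - u₂) * w₁ + (u₁ - w₁) * w₂) :
    r₁ ∈ Icc w₁ u₁ ∧ r₂ ∈ Icc u₂ w₂ := by
  have h := mem_box_of_le_of_mem_line (w₁ := -u₁) (w₂ := -u₂) (u₁ := -w₁) (u₂ := -w₂)
    (r₁ := -r₁) (r₂ := -r₂) (neg_lt_neg hβ) (neg_lt_neg hα) (neg_le_neg hp₁) (neg_le_neg hp₂)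
    (neg_le_neg h₁) (neg_le_neg h₂) (by linarith)
  simp only [mem_Icc, neg_le_neg_iff] at h
  exact ⟨h.1.symm, h.2.symm⟩

theorem notMem_of_mem_freeRegion {n : ℕ} {κ : Fin n → Fin n → Set (ℝ × ℝ)} {x : Fin n → ℝ}
    (hx : x ∈ freeRegion n κ) (i j : Fin n) : (x i, x j) ∉ κ i j := fun h =>
  hx (mem_iUnion₂.2 ⟨i, j, h⟩)

theorem exists_mem_of_mem_cylPr {n : ℕ} {κ : Fin n → Fin n → Set (ℝ × ℝ)} {x : Fin n → ℝ}
    {i j : Fin n} (hij : i ≠ j) (hx : x ∈ cylPr n κ i j) :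
    ∃ u₁ u₂ : ℝ, (u₁, u₂) ∈ κ i j ∧ x i ≤ u₁ ∧ u₂ ≤ x j := by
  obtain ⟨y, hy, a, b, ha, hb, rfl⟩ := hx
  refine ⟨y i, y j, hy, ?_, ?_⟩
  · simpa [basisVec, hij] using ha
  · simpa [basisVec, hij.symm] using hb

/-- South-West/North-East completion: the image of a feasible path is
disjoint from `χ^obs_{i≻j} ∩ χ^obs_{j≻i}`. -/
theorem stmt4 (n : ℕ) (hn : 1 ≤ n) (κ : Fin n → Fin n → Set (ℝ × ℝ))
    (hκ : KappaHyp n κ) (φ : ℝ → Fin n → ℝ)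
    (hφ : PhiMem n (freeRegion n κ) φ) (i j : Fin n) (hij : i ≠ j) :
    ∀ t ∈ Icc (0:ℝ) 1, φ t ∉ cylPr n κ i j ∩ cylPr n κ j i := by
  rintro t ht ⟨hu, hw⟩
  obtain ⟨hcont, hmono, hfree, hSW, hNE⟩ := hφ
  obtain ⟨-, -, hconv, -, hsymm⟩ := hκ
  obtain ⟨u₁, u₂, hu, hu₁, hu₂⟩ := exists_mem_of_mem_cylPr hij hu
  obtain ⟨w₂, w₁, hw, hw₂, hw₁⟩ := exists_mem_of_mem_cylPr hij.symm hw
  rw [hsymm] at hw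
  have hblock : ∀ x ∈ freeRegion n κ, x i ∈ Icc w₁ u₁ ∧ x j ∈ Icc u₂ w₂ →
      (w₂ - u₂) * x i + (u₁ - w₁) * x j ≠ (w₂ - u₂) * w₁ + (u₁ - w₁) * w₂ :=
    fun x hx hbox hl => notMem_of_mem_freeRegion hx i j
      ((hconv i j).mem_of_mem_box_of_mem_line hw hu hbox.1 hbox.2 hl)
  have hpbox : φ t i ∈ Icc w₁ u₁ ∧ φ t j ∈ Icc u₂ w₂ := ⟨⟨hw₁, hu₁⟩, hu₂, hw₂⟩
  have hp := hblock _ (hfree t ht) hpbox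
  have hβ : w₁ < u₁ := (hw₁.trans hu₁).lt_of_ne fun h => hp <| by
    rw [show φ t i = w₁ by linarith, h]; ring
  have hα : u₂ < w₂ := (hu₂.trans hw₂).lt_of_ne fun h => hp <| by
    rw [show φ t j = w₂ by linarith, h]; ring
  have hne : w₂ - u₂ + (u₁ - w₁) ≠ 0 := by linarith
  have hup : ∀ x ∈ freeRegion n κ, φ t ≤ x →
      (w₂ - u₂) * x i + (u₁ - w₁) * x j ≠ (w₂ - u₂) * w₁ + (u₁ - w₁) * w₂ :=
    fun x hx hle hl => hblock x hx
      (mem_box_of_le_of_mem_line hβ hα hw₁ hu₂ (hle i) (hle j) hl) hl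
  have hdown : ∀ x ∈ freeRegion n κ, x ≤ φ t →
      (w₂ - u₂) * x i + (u₁ - w₁) * x j ≠ (w₂ - u₂) * w₁ + (u₁ - w₁) * w₂ :=
    fun x hx hle hl => hblock x hx
      (mem_box_of_ge_of_mem_line hβ hα hu₁ hw₂ (hle i) (hle j) hl) hl
  set c := (w₂ - u₂) * w₁ + (u₁ - w₁) * w₂
  set f : ℝ → ℝ := fun s => (w₂ - u₂) * φ s i + (u₁ - w₁) * φ s j
  have hfc : ContinuousOn f (Icc 0 1) :=
    (continuousOn_const.mul ((continuousOn_pi.1 hcont) i)).add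
      (continuousOn_const.mul ((continuousOn_pi.1 hcont) j))
  have h0 : (0 : ℝ) ∈ Icc (0 : ℝ) 1 := left_mem_Icc.2 zero_le_one
  have h1 : (1 : ℝ) ∈ Icc (0 : ℝ) 1 := right_mem_Icc.2 zero_le_one
  rcases le_total (f t) c with hle | hle
  · rcases le_total c (f 1) with hend | hend
    · obtain ⟨s, hs, hsc⟩ := intermediate_value_Icc ht.2
        (hfc.mono (Icc_subset_Icc_left ht.1)) ⟨hle, hend⟩
      have hs' : s ∈ Icc (0 : ℝ) 1 := ⟨ht.1.trans hs.1, hs.2⟩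
      exact hup _ (hfree s hs') (hmono t ht s hs' hs.1) hsc
    · have hd : (0 : Fin n → ℝ) ≤ fun _ => (c - f 1) / (w₂ - u₂ + (u₁ - w₁)) := fun _ =>
        div_nonneg (sub_nonneg.2 hend) (by linarith)
      refine hup _ (hNE _ hd) ((hmono t ht 1 h1 ht.2).trans (le_add_of_nonneg_right hd)) ?_
      simp only [Pi.add_apply]
      linear_combination div_mul_cancel₀ (c - f 1) hne
  · rcases le_total (f 0) c with hend | hend
    · obtain ⟨s, hs, hsc⟩ := intermediate_value_Icc ht.1
        (hfc.mono (Icc_subset_Icc_right ht.2)) ⟨hend, hle⟩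
      have hs' : s ∈ Icc (0 : ℝ) 1 := ⟨hs.1, hs.2.trans ht.2⟩
      exact hdown _ (hfree s hs') (hmono s hs' t ht hs.2) hsc
    · have hd : (0 : Fin n → ℝ) ≤ fun _ => (f 0 - c) / (w₂ - u₂ + (u₁ - w₁)) := fun _ =>
        div_nonneg (sub_nonneg.2 hend) (by linarith)
      refine hdown _ (hSW _ hd) ((sub_le_self _ hd).trans (hmono 0 h0 t ht ht.1)) ?_
      simp only [Pi.sub_apply]
      linear_combination -div_mul_cancel₀ (f 0 - c) hne
end
end

section
/- (Invariance of the priority graph.) Two feasible paths are homotopic if and only if they induce the same priority relation. In particular, the priority graph is an invariant of the homotopy classes of feasible paths and is distinct for distinct classes, so the set of homotopy classes of feasible paths is in bijection with the set of priority graphs induced by feasible paths. -/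
open Set

noncomputable section

/-- The priority relation induced by a path `φ`: `i ≻ j` iff the image of `φ` (on
`[0,1]`) meets `χ^obs_{j≻i}`. -/
def Pri (n : ℕ) (κ : Fin n → Fin n → Set (ℝ × ℝ)) (φ : ℝ → Fin n → ℝ)
    (i j : Fin n) : Prop :=
  ∃ t ∈ Icc (0:ℝ) 1, φ t ∈ cylPr n κ j i

/-- Homotopy of feasible paths: a family `H` of feasible paths, pointwise continuous
in the homotopy parameter, joining `φ` to `ψ`. -/
def Homotopic (n : ℕ) (κ : Fin n → Fin n → Set (ℝ × ℝ))
    (φ ψ : ℝ → Fin n → ℝ) : Prop :=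
  ∃ H : ℝ → ℝ → Fin n → ℝ,
    (∀ t ∈ Icc (0:ℝ) 1, ContinuousOn (fun α => H α t) (Icc 0 1)) ∧
    H 0 = φ ∧ H 1 = ψ ∧
    ∀ α ∈ Icc (0:ℝ) 1, PhiMem n (freeRegion n κ) (H α)

section Plane

variable {K : Set (ℝ × ℝ)} {x y : ℝ → ℝ}

/-- A planar path which does not start above and does not end below `c` passes through the
lower right or the upper left quadrant at `c`. -/
lemma exists_mem_quadrant (hx : ContinuousOn x (Icc 0 1)) {c : ℝ × ℝ}
    (h0 : ¬(c.1 ≤ x 0 ∧ c.2 ≤ y 0)) (h1 : ¬(x 1 ≤ c.1 ∧ y 1 ≤ c.2)) :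
    ∃ t ∈ Icc (0:ℝ) 1, (c.1 ≤ x t ∧ y t ≤ c.2) ∨ (x t ≤ c.1 ∧ c.2 ≤ y t) := by
  rcases le_total c.1 (x 0) with h | h
  · exact ⟨0, by simp, Or.inl ⟨h, not_lt.1 fun h' => h0 ⟨h, h'.le⟩⟩⟩
  rcases le_total (x 1) c.1 with h' | h'
  · exact ⟨1, by simp, Or.inr ⟨h', not_lt.1 fun h'' => h1 ⟨h', h''.le⟩⟩⟩
  obtain ⟨t, ht, hxt⟩ := intermediate_value_Icc zero_le_one hx ⟨h, h'⟩
  exact ⟨t, ht, (le_total (y t) c.2).imp (⟨hxt.ge, ·⟩) (⟨hxt.le, ·⟩)⟩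

/-- A point of the line through `k` and `k'` lying in the box they span is in any convex set
containing `k` and `k'`. -/
lemma mem_of_mem_antidiagonal (hK : Convex ℝ K) {k k' : ℝ × ℝ} (hk : k ∈ K) (hk' : k' ∈ K)
    {a b : ℝ} (ha : k.1 ≤ a) (ha' : a ≤ k'.1) (hb : k'.2 ≤ b) (hb' : b ≤ k.2)
    (h : (k.2 - k'.2) * (a - k.1) + (k'.1 - k.1) * (b - k.2) = 0) : (a, b) ∈ K := by
  rcases (show 0 ≤ (k.2 - k'.2) + (k'.1 - k.1) by linarith).eq_or_lt with h0 | h0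
  · convert hk using 1
    ext <;> simp <;> linarith
  · have := hK.add_smul_sub_mem hk hk'
      (t := ((a - k.1) + (k.2 - b)) / ((k.2 - k'.2) + (k'.1 - k.1)))
      ⟨div_nonneg (by linarith) h0.le, (div_le_one h0).2 (by linarith)⟩
    convert this using 1
    ext
    · simp only [Prod.fst_add, Prod.smul_fst, Prod.fst_sub, smul_eq_mul]
      field_simp
      linarith
    · simp only [Prod.snd_add, Prod.smul_snd, Prod.snd_sub, smul_eq_mul]
      field_simp
      linarith

/-- A monotone path that avoids the convex set `K`, does not start above a point of `K` and does
not end below a point of `K`, never enters the box spanned by an upper left point `k` and a lower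
right point `k'` of `K`. -/
lemma not_mem_box (hK : Convex ℝ K) (hx : ContinuousOn x (Icc 0 1)) (hy : ContinuousOn y (Icc 0 1))
    (hmx : MonotoneOn x (Icc 0 1)) (hmy : MonotoneOn y (Icc 0 1))
    (hav : ∀ t ∈ Icc (0:ℝ) 1, (x t, y t) ∉ K)
    (h0 : ∀ c ∈ K, ¬(c.1 ≤ x 0 ∧ c.2 ≤ y 0)) (h1 : ∀ c ∈ K, ¬(x 1 ≤ c.1 ∧ y 1 ≤ c.2))
    {k k' : ℝ × ℝ} (hk : k ∈ K) (hk' : k' ∈ K) {r : ℝ} (hr : r ∈ Icc (0:ℝ) 1)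
    (ha : k.1 ≤ x r) (ha' : x r ≤ k'.1) (hb : k'.2 ≤ y r) (hb' : y r ≤ k.2) : False := by
  set f : ℝ → ℝ := fun t => (k.2 - k'.2) * (x t - k.1) + (k'.1 - k.1) * (y t - k.2) with hf
  have hfc : ContinuousOn f (Icc 0 1) := by fun_prop
  have hfr : f r ≠ 0 := fun h => hav r hr (mem_of_mem_antidiagonal hK hk hk' ha ha' hb hb' h)
  have hA : 0 < k.2 - k'.2 := by
    refine lt_of_le_of_ne (by linarith) fun h => hfr ?_
    rw [hf]; simp only [← h, show y r = k.2 by linarith]; ring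
  have hB : 0 < k'.1 - k.1 := by
    refine lt_of_le_of_ne (by linarith) fun h => hfr ?_
    rw [hf]; simp only [← h, show x r = k.1 by linarith]; ring
  -- the point of the diagonal with first coordinate `a`
  have hdiag : ∀ a, k.1 ≤ a → a ≤ k'.1 →
      (a, k.2 - (k.2 - k'.2) * (a - k.1) / (k'.1 - k.1)) ∈ K := by
    intro a h h'
    refine mem_of_mem_antidiagonal hK hk hk' h h' ?_ ?_ ?_
    · have : (k.2 - k'.2) * (a - k.1) / (k'.1 - k.1) ≤ k.2 - k'.2 := by
        rw [div_le_iff₀ hB]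
        exact mul_le_mul_of_nonneg_left (by linarith) hA.le
      linarith
    · have : 0 ≤ (k.2 - k'.2) * (a - k.1) / (k'.1 - k.1) :=
        div_nonneg (mul_nonneg hA.le (by linarith)) hB.le
      linarith
    · field_simp
      ring
  rcases hfr.lt_or_gt with h | h
  · have hup : ∀ t ∈ Icc r 1, f t ≤ 0 →
        k.1 ≤ x t ∧ x t ≤ k'.1 ∧ k'.2 ≤ y t ∧ y t ≤ k.2 := by
      intro t ht hft
      have ht' : t ∈ Icc (0:ℝ) 1 := ⟨hr.1.trans ht.1, ht.2⟩
      have h1 := hmx hr ht' ht.1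
      have h2 := hmy hr ht' ht.1
      simp only [hf] at hft
      refine ⟨by linarith, ?_, by linarith, ?_⟩
      · by_contra! h3
        nlinarith
      · by_contra! h3
        nlinarith
    rcases le_total 0 (f 1) with h' | h'
    · obtain ⟨t, ht, hft⟩ := intermediate_value_Icc hr.2
        (hfc.mono (Icc_subset_Icc_left hr.1)) ⟨h.le, h'⟩
      obtain ⟨p, q, u, v⟩ := hup t ht hft.le
      exact hav t ⟨hr.1.trans ht.1, ht.2⟩ (mem_of_mem_antidiagonal hK hk hk' p q u v hft)
    · obtain ⟨p, q, -, -⟩ := hup 1 ⟨hr.2, le_rfl⟩ h'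
      refine h1 _ (hdiag _ p q) ⟨le_rfl, ?_⟩
      have : (k.2 - k'.2) * (x 1 - k.1) / (k'.1 - k.1) ≤ k.2 - y 1 := by
        rw [div_le_iff₀ hB]
        simp only [hf] at h'
        linarith
      simp only
      linarith
  · have hdown : ∀ t ∈ Icc 0 r, 0 ≤ f t →
        k.1 ≤ x t ∧ x t ≤ k'.1 ∧ k'.2 ≤ y t ∧ y t ≤ k.2 := by
      intro t ht hft
      have ht' : t ∈ Icc (0:ℝ) 1 := ⟨ht.1, ht.2.trans hr.2⟩
      have h1 := hmx ht' hr ht.2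
      have h2 := hmy ht' hr ht.2
      simp only [hf] at hft
      refine ⟨?_, by linarith, ?_, by linarith⟩
      · by_contra! h3
        nlinarith
      · by_contra! h3
        nlinarith
    rcases le_total (f 0) 0 with h' | h'
    · obtain ⟨t, ht, hft⟩ := intermediate_value_Icc hr.1
        (hfc.mono (Icc_subset_Icc_right hr.2)) ⟨h', h.le⟩
      obtain ⟨p, q, u, v⟩ := hdown t ht hft.ge
      exact hav t ⟨ht.1, ht.2.trans hr.2⟩ (mem_of_mem_antidiagonal hK hk hk' p q u v hft)
    · obtain ⟨p, q, -, -⟩ := hdown 0 ⟨le_rfl, hr.1⟩ h'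
      refine h0 _ (hdiag _ p q) ⟨le_rfl, ?_⟩
      have : k.2 - y 0 ≤ (k.2 - k'.2) * (x 0 - k.1) / (k'.1 - k.1) := by
        rw [le_div_iff₀ hB]
        simp only [hf] at h'
        linarith
      simp only
      linarith

/-- A monotone path as in `not_mem_box` cannot visit first the lower right completion and then
the upper left completion of `K`. -/
lemma not_lower_right_then_upper_left (hK : Convex ℝ K) (hx : ContinuousOn x (Icc 0 1))
    (hy : ContinuousOn y (Icc 0 1)) (hmx : MonotoneOn x (Icc 0 1)) (hmy : MonotoneOn y (Icc 0 1))
    (hav : ∀ t ∈ Icc (0:ℝ) 1, (x t, y t) ∉ K)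
    (h0 : ∀ c ∈ K, ¬(c.1 ≤ x 0 ∧ c.2 ≤ y 0)) (h1 : ∀ c ∈ K, ¬(x 1 ≤ c.1 ∧ y 1 ≤ c.2))
    {k k' : ℝ × ℝ} (hk : k ∈ K) (hk' : k' ∈ K) {s t : ℝ} (hs : s ∈ Icc (0:ℝ) 1)
    (ht : t ∈ Icc (0:ℝ) 1) (hst : s ≤ t)
    (ha : k.1 ≤ x s) (hb : y s ≤ k.2) (ha' : x t ≤ k'.1) (hb' : k'.2 ≤ y t) : False := by
  have hsub : Icc s t ⊆ Icc (0:ℝ) 1 := Icc_subset_Icc hs.1 ht.2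
  have hxr : ∀ r ∈ Icc s t, k.1 ≤ x r ∧ x r ≤ k'.1 := fun r hr =>
    ⟨ha.trans (hmx hs (hsub hr) hr.1), (hmx (hsub hr) ht hr.2).trans ha'⟩
  rcases le_or_gt k'.2 k.2 with h | h
  · rcases le_total k'.2 (y s) with h' | h'
    · have := hxr s ⟨le_rfl, hst⟩
      exact not_mem_box hK hx hy hmx hmy hav h0 h1 hk hk' hs this.1 this.2 h' hb
    · obtain ⟨r, hr, hyr⟩ := intermediate_value_Icc hst (hy.mono hsub) ⟨h', hb'⟩
      have := hxr r hr
      exact not_mem_box hK hx hy hmx hmy hav h0 h1 hk hk' (hsub hr) this.1 this.2 hyr.ge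
        (hyr.le.trans h)
  · have hs' := hxr s ⟨le_rfl, hst⟩
    have ht' := hxr t ⟨hst, le_rfl⟩
    rcases (hs'.1.trans hs'.2).eq_or_lt with hB | hB
    · obtain ⟨r, hr, hyr⟩ := intermediate_value_Icc hst (hy.mono hsub) ⟨hb, h.le.trans hb'⟩
      have := hxr r hr
      refine hav r (hsub hr) ?_
      convert hk using 1
      ext
      · exact le_antisymm (by simpa [hB] using this.2) this.1
      · exact hyr
    · have hgc : ContinuousOn
          (fun t => (y t - k.2) * (k'.1 - k.1) - (x t - k.1) * (k'.2 - k.2)) (Icc s t) := by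
        have := hx.mono hsub
        have := hy.mono hsub
        fun_prop
      obtain ⟨r, hr, hgr⟩ := intermediate_value_Icc hst hgc (show (0:ℝ) ∈ Icc _ _ by
        constructor
        · nlinarith
        · nlinarith)
      have hB' : 0 < k'.1 - k.1 := by linarith
      have hxr' := hxr r hr
      have := hK.add_smul_sub_mem hk hk' (t := (x r - k.1) / (k'.1 - k.1))
        ⟨div_nonneg (by linarith) hB'.le, (div_le_one hB').2 (by linarith)⟩
      refine hav r (hsub hr) ?_
      convert this using 1
      ext
      · simp only [Prod.fst_add, Prod.smul_fst, Prod.fst_sub, smul_eq_mul]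
        field_simp
        ring
      · simp only [Prod.snd_add, Prod.smul_snd, Prod.snd_sub, smul_eq_mul]
        simp only at hgr
        field_simp
        linarith

end Plane

section Priority

variable {n : ℕ} {κ : Fin n → Fin n → Set (ℝ × ℝ)} {φ ψ : ℝ → Fin n → ℝ}

lemma mem_cylPr_iff_s7 (hκ : KappaHyp n κ) {i j : Fin n} {x : Fin n → ℝ} :
    x ∈ cylPr n κ i j ↔ ∃ k ∈ κ i j, x i ≤ k.1 ∧ k.2 ≤ x j := by
  obtain ⟨-, -, -, hd, -⟩ := hκ
  by_cases hij : i = j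
  · subst hij
    simp [cylPr, cyl, hd]
  constructor
  · rintro ⟨y, hy, a, b, ha, hb, rfl⟩
    exact ⟨_, hy, by simp [basisVec, hij, ha], by simp [basisVec, Ne.symm hij, hb]⟩
  · rintro ⟨k, hk, h1, h2⟩
    refine ⟨x + (k.1 - x i) • basisVec n i - (x j - k.2) • basisVec n j, ?_,
      k.1 - x i, x j - k.2, by linarith, by linarith, by abel⟩
    simpa [cyl, basisVec, hij, Ne.symm hij] using hk

lemma pri_iff_swap (hκ : KappaHyp n κ) {i j : Fin n} :
    Pri n κ φ j i ↔ ∃ t ∈ Icc (0:ℝ) 1, ∃ k ∈ κ i j, φ t i ≤ k.1 ∧ k.2 ≤ φ t j := by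
  simp only [Pri, mem_cylPr_iff_s7 hκ]

lemma pri_iff (hκ : KappaHyp n κ) {i j : Fin n} :
    Pri n κ φ i j ↔ ∃ t ∈ Icc (0:ℝ) 1, ∃ k ∈ κ i j, k.1 ≤ φ t i ∧ φ t j ≤ k.2 := by
  simp only [pri_iff_swap hκ]
  refine exists_congr fun t => and_congr_right fun _ => ?_
  constructor
  · rintro ⟨k, hk, h1, h2⟩
    exact ⟨(k.2, k.1), (hκ.2.2.2.2 _ _ _ _).1 hk, h2, h1⟩
  · rintro ⟨k, hk, h1, h2⟩
    exact ⟨(k.2, k.1), (hκ.2.2.2.2 _ _ _ _).1 hk, h2, h1⟩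

lemma isOpen_cylPr (hκ : KappaHyp n κ) (i j : Fin n) : IsOpen (cylPr n κ i j) := by
  rw [isOpen_iff_mem_nhds]
  intro x₀ hx₀
  obtain ⟨k, hk, h1, h2⟩ := (mem_cylPr_iff_s7 hκ).1 hx₀
  have hc : Continuous fun x : Fin n → ℝ => (k.1 + (x i - x₀ i), k.2 + (x j - x₀ j)) := by
    fun_prop
  filter_upwards [((hκ.1 i j).preimage hc).mem_nhds (by simpa using hk)] with x hx
  exact (mem_cylPr_iff_s7 hκ).2 ⟨_, hx, by simp only; linarith, by simp only; linarith⟩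

lemma mem_freeRegion {x : Fin n → ℝ} : x ∈ freeRegion n κ ↔ ∀ i j, (x i, x j) ∉ κ i j := by
  simp [freeRegion, obsRegion, cyl]

lemma PhiMem.not_le_zero (h : PhiMem n (freeRegion n κ) φ) {i j : Fin n} (hij : i ≠ j)
    {c : ℝ × ℝ} (hc : c ∈ κ i j) : ¬(c.1 ≤ φ 0 i ∧ c.2 ≤ φ 0 j) := by
  rintro ⟨h1, h2⟩
  refine mem_freeRegion.1 (h.2.2.2.1
    (Pi.single i (φ 0 i - c.1) + Pi.single j (φ 0 j - c.2)) ?_) i j ?_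
  · exact add_nonneg (Pi.single_nonneg.2 (sub_nonneg.2 h1)) (Pi.single_nonneg.2 (sub_nonneg.2 h2))
  · simpa [hij, hij.symm] using hc

lemma PhiMem.not_one_le (h : PhiMem n (freeRegion n κ) φ) {i j : Fin n} (hij : i ≠ j)
    {c : ℝ × ℝ} (hc : c ∈ κ i j) : ¬(φ 1 i ≤ c.1 ∧ φ 1 j ≤ c.2) := by
  rintro ⟨h1, h2⟩
  refine mem_freeRegion.1 (h.2.2.2.2
    (Pi.single i (c.1 - φ 1 i) + Pi.single j (c.2 - φ 1 j)) ?_) i j ?_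
  · exact add_nonneg (Pi.single_nonneg.2 (sub_nonneg.2 h1)) (Pi.single_nonneg.2 (sub_nonneg.2 h2))
  · simpa [hij, hij.symm] using hc

lemma PhiMem.continuousOn_apply {C : Set (Fin n → ℝ)} (h : PhiMem n C φ) (i : Fin n) :
    ContinuousOn (fun t => φ t i) (Icc 0 1) :=
  continuousOn_pi.1 h.1 i

lemma PhiMem.monotoneOn_apply {C : Set (Fin n → ℝ)} (h : PhiMem n C φ) (i : Fin n) :
    MonotoneOn (fun t => φ t i) (Icc 0 1) :=
  fun s hs t ht hst => h.2.1 s hs t ht hst i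

lemma KappaHyp.ne_of_mem (hκ : KappaHyp n κ) {i j : Fin n} {c : ℝ × ℝ} (hc : c ∈ κ i j) :
    i ≠ j := by
  rintro rfl
  simp [hκ.2.2.2.1 i] at hc

/-- A feasible path gives a priority to every pair with a nonempty collision region. -/
lemma PhiMem.pri_or_pri (hκ : KappaHyp n κ) (h : PhiMem n (freeRegion n κ) φ) {i j : Fin n}
    (hne : (κ i j).Nonempty) : Pri n κ φ i j ∨ Pri n κ φ j i := by
  obtain ⟨c, hc⟩ := hne
  have hij := hκ.ne_of_mem hc
  obtain ⟨t, ht, h'⟩ := exists_mem_quadrant (y := fun t => φ t j) (h.continuousOn_apply i)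
    (h.not_le_zero hij hc) (h.not_one_le hij hc)
  exact h'.imp (fun h' => (pri_iff hκ).2 ⟨t, ht, c, hc, h'⟩)
    (fun h' => (pri_iff_swap hκ).2 ⟨t, ht, c, hc, h'⟩)

/-- The priority relation of a feasible path is asymmetric. -/
lemma PhiMem.not_pri_and_pri (hκ : KappaHyp n κ) (h : PhiMem n (freeRegion n κ) φ) {i j : Fin n}
    (h1 : Pri n κ φ i j) (h2 : Pri n κ φ j i) : False := by
  wlog hst : ∃ s ∈ Icc (0:ℝ) 1, ∃ t ∈ Icc (0:ℝ) 1, s ≤ t ∧ φ s ∈ cylPr n κ j i ∧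
      φ t ∈ cylPr n κ i j generalizing i j
  · obtain ⟨s, hs, h1'⟩ := h1
    obtain ⟨t, ht, h2'⟩ := h2
    rcases le_total s t with hle | hle
    · exact hst ⟨s, hs, t, ht, hle, h1', h2'⟩
    · exact this ⟨t, ht, h2'⟩ ⟨s, hs, h1'⟩ ⟨t, ht, s, hs, hle, h2', h1'⟩
  obtain ⟨s, hs, t, ht, hle, h1, h2⟩ := hst
  obtain ⟨k, hk, ha, hb⟩ := (mem_cylPr_iff_s7 hκ).1 h1
  obtain ⟨k', hk', ha', hb'⟩ := (mem_cylPr_iff_s7 hκ).1 h2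
  have hij := hκ.ne_of_mem hk'
  exact not_lower_right_then_upper_left (hκ.2.2.1 i j) (h.continuousOn_apply i)
    (h.continuousOn_apply j) (h.monotoneOn_apply i) (h.monotoneOn_apply j)
    (fun t ht => mem_freeRegion.1 (h.2.2.1 t ht) i j) (fun c hc => h.not_le_zero hij hc)
    (fun c hc => h.not_one_le hij hc) (k := (k.2, k.1)) ((hκ.2.2.2.2 _ _ _ _).1 hk) hk'
    hs ht hle hb ha ha' hb'

/-- The path `φ` lets robot `i` go through the collision region `κ i j` before robot `j`: it avoids
the upper left completion of the region, starts with `j` before it and ends with `i` beyond it. -/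
structure Respects (κ : Fin n → Fin n → Set (ℝ × ℝ)) (φ : ℝ → Fin n → ℝ) (i j : Fin n) :
    Prop where
  avoid : ∀ t ∈ Icc (0:ℝ) 1, ∀ k ∈ κ i j, ¬(φ t i ≤ k.1 ∧ k.2 ≤ φ t j)
  start : ∀ k ∈ κ i j, φ 0 j < k.2
  finish : ∀ k ∈ κ i j, k.1 < φ 1 i

lemma PhiMem.respects (hκ : KappaHyp n κ) (h : PhiMem n (freeRegion n κ) φ) {i j : Fin n}
    (hp : ¬Pri n κ φ j i) : Respects κ φ i j := by
  have hav : ∀ t ∈ Icc (0:ℝ) 1, ∀ k ∈ κ i j, ¬(φ t i ≤ k.1 ∧ k.2 ≤ φ t j) :=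
    fun t ht k hk hh => hp ((pri_iff_swap hκ).2 ⟨t, ht, k, hk, hh⟩)
  refine ⟨hav, fun k hk => ?_, fun k hk => ?_⟩
  · by_contra! hh
    rcases le_total k.1 (φ 0 i) with h' | h'
    · exact h.not_le_zero (hκ.ne_of_mem hk) hk ⟨h', hh⟩
    · exact hav 0 (by simp) k hk ⟨h', hh⟩
  · by_contra! hh
    rcases le_total k.2 (φ 1 j) with h' | h'
    · exact hav 1 (by simp) k hk ⟨hh, h'⟩
    · exact h.not_one_le (hκ.ne_of_mem hk) hk ⟨hh, h'⟩

lemma phiMem_of_respects (hκ : KappaHyp n κ) (hc : ContinuousOn φ (Icc 0 1))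
    (hm : ∀ s ∈ Icc (0:ℝ) 1, ∀ t ∈ Icc (0:ℝ) 1, s ≤ t → φ s ≤ φ t)
    (hr : ∀ i j, Respects κ φ i j ∨ Respects κ φ j i) : PhiMem n (freeRegion n κ) φ := by
  refine ⟨hc, hm, fun t ht => mem_freeRegion.2 fun i j hk => ?_,
    fun d hd => mem_freeRegion.2 fun i j hk => ?_, fun d hd => mem_freeRegion.2 fun i j hk => ?_⟩
  all_goals
    have hk' := (hκ.2.2.2.2 _ _ _ _).1 hk
    have hsw := hr i j
  · exact hsw.elim (fun h => h.avoid t ht _ hk ⟨le_rfl, le_rfl⟩)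
      (fun h => h.avoid t ht _ hk' ⟨le_rfl, le_rfl⟩)
  · have hi := hd i
    have hj := hd j
    rcases hsw with h | h
    · have := h.start _ hk
      simp at this hi hj
      linarith
    · have := h.start _ hk'
      simp at this hi hj
      linarith
  · have hi := hd i
    have hj := hd j
    rcases hsw with h | h
    · have := h.finish _ hk
      simp at this hi hj
      linarith
    · have := h.finish _ hk'
      simp at this hi hj
      linarith

/-- The extension of `φ` to nonpositive times which goes down with speed `C` in all coordinates. -/
def extendDown (C : ℝ) (φ : ℝ → Fin n → ℝ) (s : ℝ) : Fin n → ℝ :=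
  φ (projIcc (0:ℝ) 1 zero_le_one s) + fun _ => C * min s 0

variable {C : ℝ}

lemma extendDown_of_mem {s : ℝ} (hs : s ∈ Icc (0:ℝ) 1) : extendDown C φ s = φ s := by
  ext i
  simp [extendDown, projIcc_of_mem _ hs, hs.1]

lemma extendDown_of_nonpos {s : ℝ} (hs : s ≤ 0) (i : Fin n) :
    extendDown C φ s i = φ 0 i + C * s := by
  simp [extendDown, projIcc_of_le_left _ hs, hs]

lemma continuous_extendDown (h : ContinuousOn φ (Icc 0 1)) : Continuous (extendDown C φ) := by
  have h1 : Continuous fun s => φ (projIcc (0:ℝ) 1 zero_le_one s) :=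
    h.comp_continuous (continuous_subtype_val.comp continuous_projIcc) fun s => Subtype.coe_prop _
  exact h1.add (by fun_prop)

lemma continuous_sup_extendDown (hφ : ContinuousOn φ (Icc 0 1)) (hψ : ContinuousOn ψ (Icc 0 1))
    {f g : ℝ → ℝ} (hf : Continuous f) (hg : Continuous g) :
    Continuous fun s => extendDown C φ (f s) ⊔ extendDown C ψ (g s) :=
  continuous_pi fun i =>
    ((continuous_apply i).comp ((continuous_extendDown hφ).comp hf)).sup
      ((continuous_apply i).comp ((continuous_extendDown hψ).comp hg))

lemma monotone_extendDown (hC : 0 ≤ C)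
    (hm : ∀ s ∈ Icc (0:ℝ) 1, ∀ t ∈ Icc (0:ℝ) 1, s ≤ t → φ s ≤ φ t) :
    Monotone (extendDown C φ) := by
  intro s t hst
  refine add_le_add (hm _ (Subtype.coe_prop _) _ (Subtype.coe_prop _)
    (monotone_projIcc _ hst)) fun _ => ?_
  exact mul_le_mul_of_nonneg_left (min_le_min_right _ hst) hC

lemma Respects.not_extendDown {i j : Fin n} (h : Respects κ φ i j) (hC : 0 ≤ C) {s : ℝ}
    (hs : s ≤ 1) {k : ℝ × ℝ} (hk : k ∈ κ i j) :
    ¬(extendDown C φ s i ≤ k.1 ∧ k.2 ≤ extendDown C φ s j) := by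
  rcases le_total s 0 with h0 | h0
  · rintro ⟨-, h2⟩
    rw [extendDown_of_nonpos h0] at h2
    have := h.start k hk
    have := mul_nonpos_of_nonneg_of_nonpos hC h0
    linarith
  · rw [extendDown_of_mem ⟨h0, hs⟩]
    exact h.avoid s ⟨h0, hs⟩ k hk

/-- Delayed extended paths may be combined by a pointwise maximum, as long as one of the two is
not delayed. -/
lemma Respects.sup_extendDown {i j : Fin n} (h : Respects κ φ i j) (h' : Respects κ ψ i j)
    (hC : 0 ≤ C) {a b : ℝ} (ha : 0 ≤ a) (hb : 0 ≤ b) (hab : a = 0 ∨ b = 0) :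
    Respects κ (fun t => extendDown C φ (t - a) ⊔ extendDown C ψ (t - b)) i j := by
  refine ⟨fun t ht k hk => ?_, fun k hk => ?_, fun k hk => ?_⟩
  · rintro ⟨h1, h2⟩
    rw [Pi.sup_apply, sup_le_iff] at h1
    rw [Pi.sup_apply, le_sup_iff] at h2
    rcases h2 with h2 | h2
    · exact h.not_extendDown hC (by linarith [ht.2]) hk ⟨h1.1, h2⟩
    · exact h'.not_extendDown hC (by linarith [ht.2]) hk ⟨h1.2, h2⟩
  · have h1 := h.start k hk
    have h2 := h'.start k hk
    have := mul_nonneg hC ha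
    have := mul_nonneg hC hb
    rw [Pi.sup_apply, sup_lt_iff, extendDown_of_nonpos (by linarith),
      extendDown_of_nonpos (by linarith)]
    constructor <;> linarith
  · have h1 := h.finish k hk
    have h2 := h'.finish k hk
    rw [Pi.sup_apply, lt_sup_iff]
    rcases hab with rfl | rfl
    · left
      rwa [sub_zero, extendDown_of_mem (by simp)]
    · right
      rwa [sub_zero, extendDown_of_mem (by simp)]

lemma exists_speed (φ ψ : ℝ → Fin n → ℝ) :
    ∃ C : ℝ, 0 ≤ C ∧ (∀ i, φ 0 i - C ≤ ψ 0 i) ∧ ∀ i, ψ 0 i - C ≤ φ 0 i := by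
  refine ⟨‖φ 0 - ψ 0‖, norm_nonneg _, fun i => ?_, fun i => ?_⟩ <;>
  · have := abs_le.1 ((Real.norm_eq_abs _).ge.trans (norm_le_pi_norm (φ 0 - ψ 0) i))
    simp only [Pi.sub_apply] at this
    linarith

lemma extendDown_le {C : ℝ} (hC : 0 ≤ C) (h0 : ∀ i, φ 0 i - C ≤ ψ 0 i)
    (hm : ∀ s ∈ Icc (0:ℝ) 1, ∀ t ∈ Icc (0:ℝ) 1, s ≤ t → ψ s ≤ ψ t) {t : ℝ}
    (ht : t ∈ Icc (0:ℝ) 1) : extendDown C φ (t - 2) ≤ extendDown C ψ t := by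
  intro i
  rw [extendDown_of_nonpos (by linarith [ht.2]), extendDown_of_mem ht]
  have := hm 0 (by simp) t ht ht.1 i
  have := mul_le_mul_of_nonneg_left (show t - 2 ≤ -1 by linarith [ht.2]) hC
  linarith [h0 i]

/-- Feasible paths respecting a common orientation of every pair are homotopic, through
their pointwise maximum. -/
lemma homotopic_of_respects (hκ : KappaHyp n κ) (hφ : PhiMem n (freeRegion n κ) φ)
    (hψ : PhiMem n (freeRegion n κ) ψ)
    (hr : ∀ i j, (Respects κ φ i j ∧ Respects κ ψ i j) ∨ (Respects κ φ j i ∧ Respects κ ψ j i)) :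
    Homotopic n κ φ ψ := by
  classical
  obtain ⟨C, hC, h1, h2⟩ := exists_speed φ ψ
  have hmφ := monotone_extendDown hC hφ.2.1
  have hmψ := monotone_extendDown hC hψ.2.1
  let G : ℝ → ℝ → Fin n → ℝ := fun α t =>
    extendDown C φ (t - 2 * max 0 (2 * α - 1)) ⊔ extendDown C ψ (t - 2 * max 0 (1 - 2 * α))
  have hG0 : ∀ t ∈ Icc (0:ℝ) 1, G 0 t = φ t := by
    intro t ht
    have h := extendDown_le hC h2 hφ.2.1 ht
    have e := extendDown_of_mem (C := C) (φ := φ) ht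
    norm_num [G]
    rw [sup_of_le_left h, e]
  have hG1 : ∀ t ∈ Icc (0:ℝ) 1, G 1 t = ψ t := by
    intro t ht
    have h := extendDown_le hC h1 hψ.2.1 ht
    have e := extendDown_of_mem (C := C) (φ := ψ) ht
    norm_num [G]
    rw [sup_of_le_right h, e]
  have hGmem : ∀ α, PhiMem n (freeRegion n κ) (G α) := by
    intro α
    refine phiMem_of_respects hκ (continuous_sup_extendDown hφ.1 hψ.1
      (by fun_prop) (by fun_prop)).continuousOn ?_ ?_
    · intro s _ t _ hst
      exact sup_le_sup (hmφ (by linarith)) (hmψ (by linarith))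
    · have ha : 0 ≤ 2 * max 0 (2 * α - 1) := by positivity
      have hb : 0 ≤ 2 * max 0 (1 - 2 * α) := by positivity
      have hab : 2 * max 0 (2 * α - 1) = 0 ∨ 2 * max 0 (1 - 2 * α) = 0 := by
        rcases le_total (2 * α) 1 with h | h
        · left; simp [h]
        · right; simp [h]
      exact fun i j => (hr i j).imp (fun h => h.1.sup_extendDown h.2 hC ha hb hab)
        (fun h => h.1.sup_extendDown h.2 hC ha hb hab)
  -- off the unit interval, the homotopy must still agree with the two given functions
  let H : ℝ → ℝ → Fin n → ℝ := fun α t =>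
    if t ∈ Icc (0:ℝ) 1 then G α t else if α = 0 then φ t else ψ t
  have hH : ∀ α, ∀ t ∈ Icc (0:ℝ) 1, H α t = G α t := fun α t ht => if_pos ht
  refine ⟨H, fun t ht => ?_, ?_, ?_, fun α _ => ?_⟩
  · have : Continuous fun α => G α t :=
      continuous_sup_extendDown hφ.1 hψ.1 (by fun_prop) (by fun_prop)
    simpa only [hH _ t ht] using this.continuousOn
  · ext1 t
    by_cases ht : t ∈ Icc (0:ℝ) 1
    · rw [hH _ t ht, hG0 t ht]
    · simp only [H, if_neg ht, if_true]
  · ext1 t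
    by_cases ht : t ∈ Icc (0:ℝ) 1
    · rw [hH _ t ht, hG1 t ht]
    · simp only [H, if_neg ht, one_ne_zero, if_false]
  · obtain ⟨g1, g2, g3, g4, g5⟩ := hGmem α
    refine ⟨g1.congr (hH α), fun s hs t ht hst => ?_, fun t ht => ?_, ?_, ?_⟩
    · rw [hH α s hs, hH α t ht]
      exact g2 s hs t ht hst
    · rw [hH α t ht]
      exact g3 t ht
    · rwa [hH α 0 (by simp)]
    · rwa [hH α 1 (by simp)]

/-- The priority relation is constant along a homotopy. -/
lemma Homotopic.pri_iff_pri (hκ : KappaHyp n κ) (h : Homotopic n κ φ ψ) {i j : Fin n} :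
    Pri n κ φ i j ↔ Pri n κ ψ i j := by
  obtain ⟨H, hc, rfl, rfl, hm⟩ := h
  have hopen : ∀ i j, IsOpen {α : Icc (0:ℝ) 1 | Pri n κ (H α) i j} := by
    intro i j
    have : {α : Icc (0:ℝ) 1 | Pri n κ (H α) i j} =
        ⋃ t ∈ Icc (0:ℝ) 1, {α : Icc (0:ℝ) 1 | H α t ∈ cylPr n κ j i} := by
      ext α
      simp [Pri]
    rw [this]
    exact isOpen_biUnion fun t ht =>
      (isOpen_cylPr hκ j i).preimage (continuousOn_iff_continuous_domRestrict.1 (hc t ht))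
  by_cases hne : (κ i j).Nonempty
  · have hcompl : {α : Icc (0:ℝ) 1 | Pri n κ (H α) i j}ᶜ =
        {α : Icc (0:ℝ) 1 | Pri n κ (H α) j i} := by
      ext α
      have hα := hm α α.2
      exact ⟨fun h => (hα.pri_or_pri hκ hne).resolve_left h,
        fun h h' => hα.not_pri_and_pri hκ h' h⟩
    have hclopen : IsClopen {α : Icc (0:ℝ) 1 | Pri n κ (H α) i j} :=
      ⟨⟨hcompl ▸ hopen j i⟩, hopen i j⟩
    have hconst : ∀ α β : Icc (0:ℝ) 1, Pri n κ (H α) i j ↔ Pri n κ (H β) i j := by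
      rcases isClopen_iff.1 hclopen with h | h
      · rw [eq_empty_iff_forall_notMem] at h
        exact fun α β => iff_of_false (h α) (h β)
      · rw [eq_univ_iff_forall] at h
        exact fun α β => iff_of_true (h α) (h β)
    exact hconst ⟨0, by simp⟩ ⟨1, by simp⟩
  · rw [not_nonempty_iff_eq_empty] at hne
    simp [pri_iff hκ, hne]

lemma respects_of_eq_empty {i j : Fin n} (h : κ i j = ∅) : Respects κ φ i j := by
  constructor <;> simp [h]

end Priority

/-- invariance of the priority graph: two feasible paths are homotopic
if and only if they induce the same priority relation. -/
theorem stmt7 (n : ℕ) (hn : 1 ≤ n) (κ : Fin n → Fin n → Set (ℝ × ℝ))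
    (hκ : KappaHyp n κ) (φ ψ : ℝ → Fin n → ℝ)
    (hφ : PhiMem n (freeRegion n κ) φ) (hψ : PhiMem n (freeRegion n κ) ψ) :
    Homotopic n κ φ ψ ↔ ∀ i j : Fin n, (Pri n κ φ i j ↔ Pri n κ ψ i j) := by
  refine ⟨fun h i j => h.pri_iff_pri hκ, fun h => homotopic_of_respects hκ hφ hψ fun i j => ?_⟩
  by_cases hne : (κ i j).Nonempty
  · rcases hφ.pri_or_pri hκ hne with hp | hp
    · exact Or.inl ⟨hφ.respects hκ fun hp' => hφ.not_pri_and_pri hκ hp hp',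
        hψ.respects hκ fun hp' => hψ.not_pri_and_pri hκ ((h i j).1 hp) hp'⟩
    · exact Or.inr ⟨hφ.respects hκ fun hp' => hφ.not_pri_and_pri hκ hp hp',
        hψ.respects hκ fun hp' => hψ.not_pri_and_pri hκ ((h j i).1 hp) hp'⟩
  · rw [not_nonempty_iff_eq_empty] at hne
    exact Or.inl ⟨respects_of_eq_empty hne, respects_of_eq_empty hne⟩
end
end

section
/- Every acyclic priority graph is feasible: if G is a priority graph containing no directed cycle, then Φ(χ^free_G) ≠ ∅, i.e., there exists a continuous nondecreasing path φ : [0,1] → χ with image contained in χ^free_G, φ(0) − ℝ₊^n ⊆ χ^free_G, and φ(1) + ℝ₊^n ⊆ χ^free_G. -/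
open Set

noncomputable section

/-- A priority graph: `E i j ↔ (χ^obs_{ij} ≠ ∅ ∧ ¬ E j i)`. -/
def IsPriorityGraph (n : ℕ) (κ : Fin n → Fin n → Set (ℝ × ℝ))
    (E : Fin n → Fin n → Prop) : Prop :=
  ∀ i j, E i j ↔ (cyl n κ i j ≠ ∅ ∧ ¬ E j i)

/-- Completed obstacle region `χ^obs_G = ⋃_{(i,j) ∈ E(G)} χ^obs_{i≻j}`. -/
def obsG (n : ℕ) (κ : Fin n → Fin n → Set (ℝ × ℝ))
    (E : Fin n → Fin n → Prop) : Set (Fin n → ℝ) :=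
  ⋃ i, ⋃ j, ⋃ (_ : E i j), cylPr n κ i j

/-- `χ^free_G = χ \ χ^obs_G`. -/
def freeG (n : ℕ) (κ : Fin n → Fin n → Set (ℝ × ℝ))
    (E : Fin n → Fin n → Prop) : Set (Fin n → ℝ) :=
  (obsG n κ E)ᶜ

/-- `E` contains a directed cycle. -/
def HasCycle (n : ℕ) (E : Fin n → Fin n → Prop) : Prop :=
  ∃ (m : ℕ) (v : ℕ → Fin n), 0 < m ∧ v m = v 0 ∧ ∀ k < m, E (v k) (v (k+1))

/-- The obstacle region lies in a bounded region: there are `x̲^obs, x̄^obs ∈ χ^free`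
bounding every collision cylinder in the relevant coordinates. -/
def ObsBounds (n : ℕ) (κ : Fin n → Fin n → Set (ℝ × ℝ))
    (xlo xhi : Fin n → ℝ) : Prop :=
  xlo ∈ freeRegion n κ ∧ xhi ∈ freeRegion n κ ∧
  ∀ i j : Fin n, ∀ x ∈ cyl n κ i j,
    (xlo i < x i ∧ x i < xhi i) ∧ (xlo j < x j ∧ x j < xhi j)

/-- A chain of related elements can be indexed as a walk of positive length. -/
theorem exists_walk_of_transGen {α : Type*} {E : α → α → Prop} {a b : α}
    (h : Relation.TransGen E a b) :
    ∃ (m : ℕ) (v : ℕ → α), 0 < m ∧ v 0 = a ∧ v m = b ∧ ∀ k < m, E (v k) (v (k + 1)) := by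
  induction h using Relation.TransGen.head_induction_on with
  | @single c hc => exact ⟨1, fun k => if k = 0 then c else b, by simp [hc]⟩
  | @head c d hcd _ ih =>
    obtain ⟨m, v, -, h0, hend, hv⟩ := ih
    refine ⟨m + 1, fun k => Nat.casesOn k c v, by omega, rfl, hend, ?_⟩
    rintro (_ | k) hk
    · simpa [h0] using hcd
    · exact hv k (by omega)

/-- An acyclic relation on `Fin n` has a topological rank with values below `n + 1`. -/
theorem exists_rank_of_not_hasCycle {n : ℕ} {E : Fin n → Fin n → Prop}
    (h : ¬ HasCycle n E) : ∃ r : Fin n → ℕ, (∀ i, r i ≤ n) ∧ ∀ i j, E i j → r i < r j := by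
  classical
  have irrefl : ∀ i, ¬ Relation.TransGen E i i := by
    intro i hi
    obtain ⟨m, v, hm, h0, hend, hv⟩ := exists_walk_of_transGen hi
    exact h ⟨m, v, hm, hend.trans h0.symm, hv⟩
  refine ⟨fun i => (Finset.univ.filter fun k => Relation.TransGen E k i).card, fun i => ?_,
    fun i j hij => Finset.card_lt_card ?_⟩
  · simpa using Finset.card_le_univ (Finset.univ.filter fun k => Relation.TransGen E k i)
  · rw [Finset.ssubset_iff_of_subset]
    · exact ⟨i, by simpa using Relation.TransGen.single hij, by simpa using irrefl i⟩
    · intro k hk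
      simp only [Finset.mem_filter, Finset.mem_univ, true_and] at hk ⊢
      exact hk.tail hij

/-- A configuration is collision free as soon as, along every edge `i → j`, either `i` has
already left the obstacle region or `j` has not entered it yet. -/
theorem mem_freeG {n : ℕ} {κ : Fin n → Fin n → Set (ℝ × ℝ)} {xlo xhi : Fin n → ℝ}
    (hbd : ObsBounds n κ xlo xhi) {E : Fin n → Fin n → Prop} (hne : ∀ i j, E i j → i ≠ j)
    {z : Fin n → ℝ} (hz : ∀ i j, E i j → xhi i ≤ z i ∨ z j ≤ xlo j) : z ∈ freeG n κ E := by
  intro hmem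
  simp only [obsG, mem_iUnion] at hmem
  obtain ⟨i, j, hij, y, hy, a, b, ha, hb, rfl⟩ := hmem
  have hb' := hbd.2.2 i j y hy
  have hne' := hne i j hij
  have h := hz i j hij
  simp only [basisVec, Pi.add_apply, Pi.sub_apply, Pi.smul_apply, smul_eq_mul, Pi.single_eq_same,
    Pi.single_eq_of_ne hne', Pi.single_eq_of_ne hne'.symm] at h
  rcases h with h | h <;> linarith [hb'.1.2, hb'.2.1]

/-- every acyclic priority graph is feasible, i.e. `Φ(χ^free_G) ≠ ∅`. -/
theorem stmt8 (n : ℕ) (hn : 1 ≤ n) (κ : Fin n → Fin n → Set (ℝ × ℝ))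
    (hκ : KappaHyp n κ) (xlo xhi : Fin n → ℝ) (hbd : ObsBounds n κ xlo xhi)
    (E : Fin n → Fin n → Prop) (hE : IsPriorityGraph n κ E)
    (hacyc : ¬ HasCycle n E) :
    ∃ φ : ℝ → Fin n → ℝ, PhiMem n (freeG n κ E) φ := by
  obtain ⟨r, hrn, hr⟩ := exists_rank_of_not_hasCycle hacyc
  have hne : ∀ i j, E i j → i ≠ j := by
    rintro i j hij rfl
    exact lt_irrefl _ (hr i i hij)
  -- Robots move one at a time, in rank order, from `xlo` to `max xlo xhi`.
  let c : ℝ → Fin n → ℝ := fun t i => max 0 (min 1 ((n + 1) * t - r i))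
  let φ : ℝ → Fin n → ℝ := fun t i => xlo i + c t i * (max (xlo i) (xhi i) - xlo i)
  have hgap : ∀ i, 0 ≤ max (xlo i) (xhi i) - xlo i := fun i => sub_nonneg.2 (le_max_left _ _)
  have hstart : ∀ (t : ℝ) i, (n + 1) * t ≤ r i → φ t i = xlo i := by
    intro t i ht
    have : c t i = 0 := max_eq_left ((min_le_right _ _).trans (sub_nonpos.2 ht))
    simp [φ, this]
  have hend : ∀ (t : ℝ) i, (r i : ℝ) + 1 ≤ (n + 1) * t → xhi i ≤ φ t i := by
    intro t i ht
    have : c t i = 1 := by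
      simp only [c]
      rw [min_eq_left (by linarith), max_eq_right zero_le_one]
    simp [φ, this]
  refine ⟨φ, ?_, ?_, ?_, ?_, ?_⟩
  · exact Continuous.continuousOn (by fun_prop)
  · intro s _ t _ hst i
    have : c s i ≤ c t i := by simp only [c]; gcongr
    exact add_le_add_right (mul_le_mul_of_nonneg_right this (hgap i)) _
  · refine fun t _ => mem_freeG hbd hne fun i j hij => ?_
    have hrij : (r i : ℝ) + 1 ≤ r j := mod_cast hr i j hij
    rcases le_total ((r i : ℝ) + 1) ((n + 1) * t) with h | h
    · exact Or.inl (hend t i h)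
    · exact Or.inr (hstart t j (h.trans hrij)).le
  · refine fun d hd => mem_freeG hbd hne fun i j _ => Or.inr ?_
    have := hstart 0 j (by simp)
    have hdj : 0 ≤ d j := hd j
    simp only [Pi.sub_apply]
    linarith
  · refine fun d hd => mem_freeG hbd hne fun i j _ => Or.inl ?_
    have := hend 1 i (by simpa using hrn i)
    have hdi : 0 ≤ d i := hd i
    simp only [Pi.add_apply]
    linarith
end
end

section
/- (Necessary condition for feasibility.) Let G be a priority graph. If Φ(χ^free_G) ≠ ∅, then for every elementary directed cycle C of G one has ⋂_{(i,j) ∈ E(C)} χ^obs_{i≻j} = ∅. -/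
open Set

noncomputable section

/-- `(m, v)` describes an elementary directed cycle of `E`: it has positive length,
closes up, all its steps are edges of `E` and it visits no vertex twice. -/
def IsElemCycle (n : ℕ) (E : Fin n → Fin n → Prop) (m : ℕ) (v : ℕ → Fin n) : Prop :=
  0 < m ∧ v m = v 0 ∧ (∀ k < m, E (v k) (v (k+1))) ∧
  ∀ k < m, ∀ l < m, v k = v l → k = l

/-- Completed cylinders are closed under decreasing coordinate `i` and increasing
coordinate `j`, and do not depend on the other coordinates. -/
theorem mem_cylPr_of_le {n : ℕ} {κ : Fin n → Fin n → Set (ℝ × ℝ)} {i j : Fin n} (hij : i ≠ j)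
    {x z : Fin n → ℝ} (hz : z ∈ cylPr n κ i j) (hi : x i ≤ z i) (hj : z j ≤ x j) :
    x ∈ cylPr n κ i j := by
  obtain ⟨y, hy, a, b, ha, hb, rfl⟩ := hz
  simp only [basisVec, Pi.add_apply, Pi.sub_apply, Pi.smul_apply, smul_eq_mul,
    Pi.single_eq_same, Pi.single_eq_of_ne hij, Pi.single_eq_of_ne hij.symm] at hi hj
  refine ⟨Function.update (Function.update x i (y i)) j (y j), ?_, y i - x i, x j - y j,
    by linarith, by linarith, ?_⟩
  · simpa [cyl, hij] using hy
  · funext k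
    by_cases hki : k = i
    · subst hki
      simp [basisVec, hij]
    · by_cases hkj : k = j
      · subst hkj
        simp [basisVec, hki]
      · simp [basisVec, hki, hkj]

/-- If `z` lies in every completed cylinder along a closed walk of `E`, then no point of
`χ^free_G` agrees with `z` at the base vertex of the walk. -/
theorem apply_ne_of_mem_freeG {n : ℕ} {κ : Fin n → Fin n → Set (ℝ × ℝ)}
    (hκ : ∀ i, κ i i = ∅) {E : Fin n → Fin n → Prop} {m : ℕ} {v : ℕ → Fin n}
    (hm : 0 < m) (hv : v m = v 0) (hEv : ∀ k < m, E (v k) (v (k + 1))) {z : Fin n → ℝ}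
    (hz : ∀ k < m, z ∈ cylPr n κ (v k) (v (k + 1))) {x : Fin n → ℝ} (hx : x ∈ freeG n κ E) :
    x (v 0) ≠ z (v 0) := by
  have step : ∀ k < m, z (v (k + 1)) ≤ x (v (k + 1)) → z (v k) < x (v k) := by
    intro k hk hle
    by_contra! hlt
    have hne : v k ≠ v (k + 1) := by
      intro h
      obtain ⟨y, hy, -⟩ := hz k hk
      rw [← h] at hy
      simp [cyl, hκ] at hy
    refine hx ?_
    simp only [obsG, mem_iUnion]
    exact ⟨_, _, hEv k hk, mem_cylPr_of_le hne (hz k hk) hlt hle⟩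
  intro h
  have descend : ∀ k ≤ m, z (v k) ≤ x (v k) := fun k hk =>
    Nat.decreasingInduction (motive := fun k _ => z (v k) ≤ x (v k))
      (fun k hk ih => (step k hk ih).le) (by rw [hv, h]) hk
  exact (step 0 hm (descend 1 hm)).ne' h

/-- necessary condition for feasibility: if `Φ(χ^free_G) ≠ ∅`, then for
every elementary directed cycle of `G`, the intersection of the completed cylinders
along the cycle is empty. -/
theorem stmt9 (n : ℕ) (hn : 1 ≤ n) (κ : Fin n → Fin n → Set (ℝ × ℝ))
    (hκ : KappaHyp n κ) (E : Fin n → Fin n → Prop) (hE : IsPriorityGraph n κ E)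
    (hfeas : ∃ φ : ℝ → Fin n → ℝ, PhiMem n (freeG n κ E) φ)
    (m : ℕ) (v : ℕ → Fin n) (hc : IsElemCycle n E m v) :
    ⋂ k ∈ Finset.range m, cylPr n κ (v k) (v (k+1)) = ∅ := by
  obtain ⟨φ, hcont, -, hfree, hstart, hend⟩ := hfeas
  obtain ⟨hm, hv, hEv, -⟩ := hc
  refine eq_empty_of_forall_notMem fun z hz => ?_
  have ne_of_free : ∀ x ∈ freeG n κ E, x (v 0) ≠ z (v 0) := fun x hx =>
    apply_ne_of_mem_freeG hκ.2.2.2.1 hm hv hEv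
      (fun k hk => by simpa using mem_iInter₂.mp hz k (Finset.mem_range.mpr hk)) hx
  have h0 : φ 0 (v 0) < z (v 0) := by
    by_contra! h
    refine ne_of_free _ (hstart ((φ 0 - z) ⊔ 0) le_sup_right) ?_
    simp [sup_eq_left.mpr (sub_nonneg.mpr h)]
  have h1 : z (v 0) < φ 1 (v 0) := by
    by_contra! h
    refine ne_of_free _ (hend ((z - φ 1) ⊔ 0) le_sup_right) ?_
    simp [sup_eq_left.mpr (sub_nonneg.mpr h)]
  obtain ⟨t, ht, heq⟩ := intermediate_value_Icc zero_le_one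
    ((continuous_apply (v 0)).comp_continuousOn hcont) ⟨h0.le, h1.le⟩
  exact ne_of_free _ (hfree t ht) heq
end
end

section
/- (Locally acyclic priority graph.) Let G be a priority graph and ε > 0. If for every elementary directed cycle C of G one has ⋂_{(i,j) ∈ E(C)} (χ^obs_{i≻j} + [−ε,ε]^n) = ∅, then for every configuration x ∈ χ the local priority graph G_{|x,ε} contains no directed cycle. -/
open Set

noncomputable section

/-- Minkowski sum (dilation) `A + [−r,r]^n`. -/
def dil (n : ℕ) (A : Set (Fin n → ℝ)) (r : ℝ) : Set (Fin n → ℝ) :=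
  {z | ∃ y ∈ A, ∃ d : Fin n → ℝ, (∀ i, |d i| ≤ r) ∧ z = y + d}

/-- A directed graph with a directed cycle has an elementary one, obtained by taking a
cycle of minimal length. -/
theorem HasCycle.exists_isElemCycle {n : ℕ} {E : Fin n → Fin n → Prop}
    (h : HasCycle n E) : ∃ (m : ℕ) (v : ℕ → Fin n), IsElemCycle n E m v := by
  obtain ⟨m, h⟩ := h
  induction m using Nat.strong_induction_on with
  | _ m ih =>
    obtain ⟨v, hm, hclosed, hedge⟩ := h
    have shorten : ∀ k l, k < l → l < m → v k = v l →
        ∃ (m' : ℕ) (w : ℕ → Fin n), IsElemCycle n E m' w := by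
      intro k l hkl hl heq
      refine ih (l - k) (by lia) ⟨fun i => v (k + i), by lia, ?_, fun i hi => ?_⟩
      · simp [Nat.add_sub_cancel' hkl.le, heq]
      · exact hedge (k + i) (by lia)
    by_cases hinj : ∀ k < m, ∀ l < m, v k = v l → k = l
    · exact ⟨m, v, hm, hclosed, hedge, hinj⟩
    · push Not at hinj
      obtain ⟨k, hk, l, hl, heq, hne⟩ := hinj
      rcases hne.lt_or_gt with hlt | hlt
      · exact shorten k l hlt hl heq
      · exact shorten l k hlt hk heq.symm

/-- locally acyclic priority graph: if for some `ε > 0` every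
elementary cycle of `G` has empty intersection of the `ε`-dilated completed
cylinders, then at every configuration `x` the local priority graph `G_{|x,ε}`
(whose edges are the edges `(i,j)` of `G` with `x ∈ χ^obs_{i≻j} + [−ε,ε]^n`)
contains no directed cycle. -/
theorem stmt11 (n : ℕ) (hn : 1 ≤ n) (κ : Fin n → Fin n → Set (ℝ × ℝ))
    (hκ : KappaHyp n κ) (E : Fin n → Fin n → Prop) (hE : IsPriorityGraph n κ E)
    (ε : ℝ) (hε : 0 < ε)
    (hcyc : ∀ (m : ℕ) (v : ℕ → Fin n), IsElemCycle n E m v →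
      ⋂ k ∈ Finset.range m, dil n (cylPr n κ (v k) (v (k+1))) ε = ∅) :
    ∀ x : Fin n → ℝ,
      ¬ HasCycle n (fun i j => E i j ∧ x ∈ dil n (cylPr n κ i j) ε) := by
  intro x h
  obtain ⟨m, v, hm, hclosed, hedge, hinj⟩ := h.exists_isElemCycle
  have hx : x ∈ ⋂ k ∈ Finset.range m, dil n (cylPr n κ (v k) (v (k+1))) ε :=
    mem_iInter₂.2 fun k hk => (hedge k (Finset.mem_range.1 hk)).2
  rw [hcyc m v ⟨hm, hclosed, fun k hk => (hedge k hk).1, hinj⟩] at hx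
  exact hx
end
end

section
/- Let X be a topological space and A, B ⊆ X disjoint subsets. If f : [0,1] → X is continuous, takes values in A ∪ B, and satisfies f(0) ∈ A and f(1) ∈ B, then there exists t⁰ ∈ [0,1] such that f(t⁰) belongs to the intersection of the topological boundary of A and the topological boundary of B (boundaries taken in X). -/
open Set

/-- if `A` and `B` are disjoint subsets of a topological space `X` and
`f : [0,1] → X` is continuous with values in `A ∪ B`, `f 0 ∈ A` and `f 1 ∈ B`, then
some point `f t⁰` with `t⁰ ∈ [0,1]` lies on the frontier of `A` and on the frontier
of `B`. -/
theorem stmt13 {X : Type*} [TopologicalSpace X] (A B : Set X) (hAB : A ∩ B = ∅)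
    (f : ℝ → X) (hf : ContinuousOn f (Icc 0 1))
    (hrange : ∀ t ∈ Icc (0:ℝ) 1, f t ∈ A ∪ B)
    (h0 : f 0 ∈ A) (h1 : f 1 ∈ B) :
    ∃ t0 ∈ Icc (0:ℝ) 1, f t0 ∈ frontier A ∩ frontier B := by
  let g : Icc (0:ℝ) 1 → X := fun t => f t
  have hg : Continuous g := continuousOn_iff_continuous_domRestrict.mp hf
  have hcompl : (g ⁻¹' A)ᶜ = g ⁻¹' B := by
    ext t
    have hA : g t ∈ A → g t ∉ B := fun ha hb =>
      (Set.ext_iff.mp hAB (g t)).mp ⟨ha, hb⟩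
    have hU : g t ∈ A ∨ g t ∈ B := hrange t t.2
    simp only [mem_compl_iff, mem_preimage]
    tauto
  have hne : (frontier (g ⁻¹' A)).Nonempty := by
    rw [nonempty_iff_ne_empty, Ne, ← isClopen_iff_frontier_eq_empty, isClopen_iff]
    rintro (h | h)
    · exact (h ▸ h0 : (0 : Icc (0:ℝ) 1) ∈ (∅ : Set (Icc (0:ℝ) 1)))
    · have hB : (1 : Icc (0:ℝ) 1) ∈ (g ⁻¹' A)ᶜ := hcompl ▸ h1
      exact hB (h ▸ mem_univ _)
  obtain ⟨t, ht⟩ := hne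
  refine ⟨t, t.2, hg.frontier_preimage_subset A ht, hg.frontier_preimage_subset B ?_⟩
  rwa [← hcompl, frontier_compl]
end

section
/- (Control law existence.) Let G be an acyclic priority graph and for each i ∈ R let v̄_i > 0. Then there exists a unique function f : χ → ℝ^n, with f_i(x) ∈ {0, v̄_i} for all x and i, satisfying for all x ∈ χ and all i ∈ R: f_i(x) = 0 if there exist (j,i) ∈ E(G) and t ∈ [0,1] with x + t(v̄_i e_i + f_j(x) e_j) ∈ χ^obs_{j≻i}, and f_i(x) = v̄_i otherwise. -/
open Set

noncomputable section

/-- The braking condition of the control law: moving robot `i` at maximal speed for one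
time slot while a higher-priority robot `j` (an edge `(j,i)` of `G`) moves at speed
`f x j` would violate the priority `j ≻ i`. -/
def CtrlCond (n : ℕ) (κ : Fin n → Fin n → Set (ℝ × ℝ)) (E : Fin n → Fin n → Prop)
    (vbar : Fin n → ℝ) (f : (Fin n → ℝ) → Fin n → ℝ) (x : Fin n → ℝ) (i : Fin n) :
    Prop :=
  ∃ j, E j i ∧ ∃ t ∈ Icc (0:ℝ) 1,
    x + t • (vbar i • basisVec n i + f x j • basisVec n j) ∈ cylPr n κ j i

/-- `f` satisfies the fixed-point definition of the priority preserving control law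
`f^G` for velocity-controlled robots: `f x i ∈ {0, v̄ i}`, `f x i = 0` when the
braking condition holds, and `f x i = v̄ i` otherwise. -/
def CtrlLawSpec (n : ℕ) (κ : Fin n → Fin n → Set (ℝ × ℝ)) (E : Fin n → Fin n → Prop)
    (vbar : Fin n → ℝ) (f : (Fin n → ℝ) → Fin n → ℝ) : Prop :=
  (∀ x i, f x i = 0 ∨ f x i = vbar i) ∧
  (∀ x i, (CtrlCond n κ E vbar f x i → f x i = 0) ∧
          (¬ CtrlCond n κ E vbar f x i → f x i = vbar i))

/-- A finite digraph without directed cycles has a well-founded edge relation. -/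
theorem wellFounded_of_not_hasCycle {n : ℕ} {E : Fin n → Fin n → Prop}
    (h : ¬ HasCycle n E) : WellFounded E := by
  have path : ∀ a b, Relation.TransGen E a b → ∃ (m : ℕ) (v : ℕ → Fin n),
      0 < m ∧ v 0 = a ∧ v m = b ∧ ∀ k < m, E (v k) (v (k + 1)) := by
    intro a b hab
    induction hab with
    | single hb =>
      rename_i b
      refine ⟨1, fun k => if k = 0 then a else b, by simp, by simp, by simp, ?_⟩
      intro k hk
      obtain rfl : k = 0 := by omega
      simpa using hb
    | tail _ hbc ih =>
      rename_i b c _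
      obtain ⟨m, v, hm, h0, hvm, hv⟩ := ih
      refine ⟨m + 1, fun k => if k ≤ m then v k else c, by simp, by simp [h0], by simp, ?_⟩
      intro k hk
      rcases Nat.lt_succ_iff_lt_or_eq.mp hk with hk | rfl
      · simpa [hk.le, Nat.succ_le_of_lt hk] using hv k hk
      · simpa [hvm] using hbc
  have : Std.Irrefl (Relation.TransGen E) := ⟨fun a ha => by
    obtain ⟨m, v, hm, h0, hvm, hv⟩ := path a a ha
    exact h ⟨m, v, hm, hvm.trans h0.symm, hv⟩⟩
  exact Subrelation.wf (fun hab => Relation.TransGen.single hab)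
    (Finite.wellFounded_of_trans_of_irrefl (Relation.TransGen E))

open Classical in
/-- The control law specification as a single fixed-point equation. -/
theorem ctrlLawSpec_iff {n : ℕ} {κ : Fin n → Fin n → Set (ℝ × ℝ)} {E : Fin n → Fin n → Prop}
    {vbar : Fin n → ℝ} {f : (Fin n → ℝ) → Fin n → ℝ} :
    CtrlLawSpec n κ E vbar f ↔
      ∀ x i, f x i = if CtrlCond n κ E vbar f x i then 0 else vbar i := by
  refine ⟨fun h x i => ?_, fun h => ⟨fun x i => ?_, fun x i => ⟨fun hc => ?_, fun hc => ?_⟩⟩⟩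
  · split_ifs with hc
    exacts [(h.2 x i).1 hc, (h.2 x i).2 hc]
  · rw [h x i]
    split_ifs <;> simp
  · rw [h x i, if_pos hc]
  · rw [h x i, if_neg hc]

/-- The braking condition for robot `i` only depends on the speeds of its predecessors. -/
theorem ctrlCond_congr {n : ℕ} {κ : Fin n → Fin n → Set (ℝ × ℝ)} {E : Fin n → Fin n → Prop}
    {vbar : Fin n → ℝ} {f g : (Fin n → ℝ) → Fin n → ℝ} {x : Fin n → ℝ} {i : Fin n}
    (h : ∀ j, E j i → f x j = g x j) :
    CtrlCond n κ E vbar f x i ↔ CtrlCond n κ E vbar g x i :=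
  exists_congr fun j => and_congr_right fun hj => by rw [h j hj]

/-- control law existence: for an acyclic priority graph `G` and maximal
speeds `v̄_i > 0`, there is a unique function `f` with `f x i ∈ {0, v̄ i}` satisfying
the fixed-point definition of the control law. -/
theorem stmt15 (n : ℕ) (hn : 1 ≤ n) (κ : Fin n → Fin n → Set (ℝ × ℝ))
    (hκ : KappaHyp n κ) (E : Fin n → Fin n → Prop) (hE : IsPriorityGraph n κ E)
    (hacyc : ¬ HasCycle n E) (vbar : Fin n → ℝ) (hv : ∀ i, 0 < vbar i) :
    ∃! f : (Fin n → ℝ) → Fin n → ℝ, CtrlLawSpec n κ E vbar f := by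
  classical
  have hwf := wellFounded_of_not_hasCycle hacyc
  let step (x : Fin n → ℝ) (i : Fin n) (speed : ∀ j, E j i → ℝ) : ℝ :=
    if CtrlCond n κ E vbar (fun _ j => if hj : E j i then speed j hj else 0) x i
    then 0 else vbar i
  refine ⟨fun x => hwf.fix (step x), ctrlLawSpec_iff.mpr fun x i => ?_, fun g hg => ?_⟩
  · rw [hwf.fix_eq]
    refine if_congr (ctrlCond_congr fun j hj => ?_) rfl rfl
    simp [hj]
  · funext x i
    induction i using hwf.induction with
    | _ i ih =>
      rw [ctrlLawSpec_iff.mp hg x i, hwf.fix_eq]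
      refine if_congr (ctrlCond_congr fun j hj => ?_) rfl rfl
      simp [hj, ih j hj]
end
end
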